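/- For every n ≥ 1, the pairs of statistics (ndes, nmaj) and (fd, fmaj) are equidistributed over B_n: Σ_{π ∈ B_n} t^{ndes(π)} q^{nmaj(π)} = Σ_{π ∈ B_n} t^{fd(π)} q^{fmaj(π)}. -/

import Mathlib

open Finset

/-- `π` is an element of the hyperoctahedral group `B_n`: a bijection of `ℤ`
satisfying `π (-a) = -π a` for all `a`, and fixing every `a` with `|a| > n`
(so it restricts to a bijection of `{-n,…,-1,1,…,n}`). -/
def IsSignedPerm (n : ℕ) (π : Equiv.Perm ℤ) : Prop :=
  (∀ a : ℤ, π (-a) = - π a) ∧ ∀ a : ℤ, (n : ℤ) < |a| → π a = a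

/-- The hyperoctahedral group `B_n`, as a set of permutations of `ℤ`. -/
def BSet (n : ℕ) : Set (Equiv.Perm ℤ) := {π | IsSignedPerm n π}

/-- The descent set `Des_A(π) = {i ∈ [n-1] : π(i) > π(i+1)}`. -/
def DesA (n : ℕ) (π : Equiv.Perm ℤ) : Finset ℕ :=
  (Finset.Icc 1 (n - 1)).filter fun i => π ((i : ℤ) + 1) < π (i : ℤ)

/-- `des_A(π)`, the number of descents of the window `π(1),…,π(n)`. -/
def desA (n : ℕ) (π : Equiv.Perm ℤ) : ℕ := (DesA n π).card

/-- `maj_A(π) = Σ_{i : π(i) > π(i+1)} i`. -/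
def majA (n : ℕ) (π : Equiv.Perm ℤ) : ℕ := ∑ i ∈ DesA n π, i

/-- `Neg(π) = {i ∈ [n] : π(i) < 0}`. -/
def NegSet (n : ℕ) (π : Equiv.Perm ℤ) : Finset ℕ :=
  (Finset.Icc 1 n).filter fun i => π (i : ℤ) < 0

/-- `neg(π) = |Neg(π)|`. -/
def negStat (n : ℕ) (π : Equiv.Perm ℤ) : ℕ := (NegSet n π).card

/-- `-Σ_{i ∈ Neg(π)} π(i) = Σ_{i ∈ Neg(π)} |π(i)|`, as a natural number. -/
def negSum (n : ℕ) (π : Equiv.Perm ℤ) : ℕ := ∑ i ∈ NegSet n π, (π (i : ℤ)).natAbs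

/-- `inv(π) = #{(i,j) : 1 ≤ i < j ≤ n, π(i) > π(j)}`. -/
def invStat (n : ℕ) (π : Equiv.Perm ℤ) : ℕ :=
  (((Finset.Icc 1 n) ×ˢ (Finset.Icc 1 n)).filter
    (fun p => p.1 < p.2 ∧ π ((p.2 : ℕ) : ℤ) < π ((p.1 : ℕ) : ℤ))).card

/-- The Coxeter length `ℓ(π) = inv(π) - Σ_{i ∈ Neg(π)} π(i)`. -/
def lenB (n : ℕ) (π : Equiv.Perm ℤ) : ℕ := invStat n π + negSum n π

/-- The negative major index `nmaj(π) = maj_A(π) - Σ_{i ∈ Neg(π)} π(i)`. -/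
def nmaj (n : ℕ) (π : Equiv.Perm ℤ) : ℕ := majA n π + negSum n π

/-- The negative descent number `ndes(π) = des_A(π) + neg(π)`. -/
def ndes (n : ℕ) (π : Equiv.Perm ℤ) : ℕ := desA n π + negStat n π

/-- The flag major index `fmaj(π) = 2 maj_A(π) + neg(π)`. -/
def fmaj (n : ℕ) (π : Equiv.Perm ℤ) : ℕ := 2 * majA n π + negStat n π

/-- The flag descent number `fd(π) = 2 des_A(π) + ε₁(π)`. -/
def fd (n : ℕ) (π : Equiv.Perm ℤ) : ℕ :=
  2 * desA n π + (if π 1 < 0 then 1 else 0)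

/-- The symmetric group `S_n`, embedded in `B_n` as the signed permutations
with all window entries positive. -/
def SnSet (n : ℕ) : Set (Equiv.Perm ℤ) :=
  {π | IsSignedPerm n π ∧ ∀ i ∈ Finset.Icc 1 n, 0 < π (i : ℤ)}

/-- `T = {π ∈ B_n : des_A(π) = 0}`. -/
def TSet (n : ℕ) : Set (Equiv.Perm ℤ) :=
  {π | IsSignedPerm n π ∧ desA n π = 0}

namespace SignedWord

/-- `1` if the word `x :: l` has a descent at its first position, else `0`. -/
def headDes (x : ℤ) : List ℤ → ℕ
  | [] => 0
  | y :: _ => if y < x then 1 else 0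

/-- The number of descents of a word. -/
def des : List ℤ → ℕ
  | [] => 0
  | x :: l => headDes x l + des l

/-- The major index of a word: the sum of the positions of its descents. -/
def maj : List ℤ → ℕ
  | [] => 0
  | x :: l => headDes x l + des l + maj l

/-- The number of negative letters of a word. -/
def neg : List ℤ → ℕ
  | [] => 0
  | x :: l => (if x < 0 then 1 else 0) + neg l

/-- The sum of the absolute values of the negative letters of a word. -/
def negAbs : List ℤ → ℕ
  | [] => 0
  | x :: l => (if x < 0 then x.natAbs else 0) + negAbs l

/-- `1` if the first letter of a word is negative, else `0`. -/
def headNeg : List ℤ → ℕ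
  | [] => 0
  | x :: _ => if x < 0 then 1 else 0

/-- The words of the elements of `B_n`, obtained by inserting `±1, …, ±n` successively. -/
def words : ℕ → List (List ℤ)
  | 0 => [[]]
  | n + 1 => (words n).flatMap fun w =>
      List.permutations'Aux ((n : ℤ) + 1) w ++ List.permutations'Aux (-((n : ℤ) + 1)) w

theorem perm_of_mem_permutations'Aux {α : Type*} {a : α} {w v : List α}
    (h : v ∈ List.permutations'Aux a w) : v.Perm (a :: w) := by
  induction w generalizing v with
  | nil => simp_all [List.permutations'Aux]
  | cons y w ih =>
    simp only [List.permutations'Aux, List.mem_cons, List.mem_map] at h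
    rcases h with rfl | ⟨u, hu, rfl⟩
    · exact List.Perm.refl _
    · exact ((ih hu).cons y).trans (List.Perm.swap _ _ _)

theorem append_cons_mem_permutations'Aux {α : Type*} (a : α) (l₁ l₂ : List α) :
    l₁ ++ a :: l₂ ∈ List.permutations'Aux a (l₁ ++ l₂) := by
  induction l₁ with
  | nil => cases l₂ <;> simp [List.permutations'Aux]
  | cons y l₁ ih => simp [List.permutations'Aux, ih]

theorem neg_eq_of_perm {v w : List ℤ} (h : v.Perm w) : neg v = neg w := by
  induction h with
  | nil => rfl
  | cons x _ ih => simp [neg, ih]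
  | swap x y l => simp only [neg]; omega
  | trans _ _ ih₁ ih₂ => rw [ih₁, ih₂]

theorem negAbs_eq_of_perm {v w : List ℤ} (h : v.Perm w) : negAbs v = negAbs w := by
  induction h with
  | nil => rfl
  | cons x _ ih => simp [negAbs, ih]
  | swap x y l => simp only [negAbs]; omega
  | trans _ _ ih₁ ih₂ => rw [ih₁, ih₂]

section Weights

variable {R : Type*} [CommRing R]

/-- The monomial `t ^ des w * q ^ maj w`. -/
def wt (t q : R) (w : List ℤ) : R := t ^ des w * q ^ maj w

theorem wt_cons (t q : R) (x : ℤ) (l : List ℤ) :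
    wt t q (x :: l) = (t * q) ^ headDes x l * wt (t * q) q l := by
  simp only [wt, des, maj]; ring

theorem wt_mul_left (t q s : R) (w : List ℤ) : wt (t * s) q w = s ^ des w * wt t q w := by
  simp only [wt]; ring

theorem sum_wt_insert_max (t q : R) (a y : ℤ) (w : List ℤ) (hy : y < a) (hw : ∀ x ∈ w, x < a) :
    (1 - q) * ((List.permutations'Aux a w).map fun v => wt t q (y :: v)).sum =
      wt t q (y :: w) * (1 - q ^ (des (y :: w) + 1) + t * q ^ (des (y :: w) + 2) -
        t * q ^ (w.length + 2)) := by
  induction w generalizing t y with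
  | nil => simp [List.permutations'Aux, wt, des, maj, headDes, hy.not_gt]
  | cons z zs ih =>
    have hz : z < a := hw z (by simp)
    have ih := ih (t * q) z hz fun x hx => hw x (by simp [hx])
    simp only [List.permutations'Aux, List.map_cons, List.sum_cons, List.map_map,
      Function.comp_def, List.length_cons]
    have e₁ : ∀ v, wt t q (y :: z :: v) = (t * q) ^ headDes y [z] * wt (t * q) q (z :: v) :=
      fun v => wt_cons t q y (z :: v)
    have e₂ : wt t q (y :: a :: z :: zs) =
        t * q * q * (q ^ des (z :: zs) * wt (t * q) q (z :: zs)) := by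
      rw [wt_cons, wt_cons, ← wt_mul_left]
      simp [headDes, hy.le, hz, not_lt]
    have e₃ : des (y :: z :: zs) = headDes y [z] + des (z :: zs) := rfl
    simp only [e₁, e₃, e₂, List.sum_map_mul_left]
    rw [mul_add, mul_left_comm (1 - q) ((t * q) ^ _), ih]
    generalize wt (t * q) q (z :: zs) = W
    generalize des (z :: zs) = d
    obtain h | h : headDes y [z] = 0 ∨ headDes y [z] = 1 := by
      simp only [headDes]; split_ifs <;> simp
    all_goals rw [h]; ring

theorem sum_wt_insert_min (t q : R) (a y : ℤ) (w : List ℤ) (hy : a < y) (hw : ∀ x ∈ w, a < x) :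
    (1 - q) * ((List.permutations'Aux a w).map fun v => wt t q (y :: v)).sum =
      wt t q (y :: w) * (1 - q ^ des (y :: w) + t * q ^ (des (y :: w) + 1) -
        t * q ^ (w.length + 2)) := by
  induction w generalizing t y with
  | nil => simp [List.permutations'Aux, wt, des, maj, headDes, hy]; ring
  | cons z zs ih =>
    have hz : a < z := hw z (by simp)
    have ih := ih (t * q) z hz fun x hx => hw x (by simp [hx])
    simp only [List.permutations'Aux, List.map_cons, List.sum_cons, List.map_map,
      Function.comp_def, List.length_cons]
    have e₁ : ∀ v, wt t q (y :: z :: v) = (t * q) ^ headDes y [z] * wt (t * q) q (z :: v) :=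
      fun v => wt_cons t q y (z :: v)
    have e₂ : wt t q (y :: a :: z :: zs) =
        t * q * (q ^ des (z :: zs) * wt (t * q) q (z :: zs)) := by
      rw [wt_cons, wt_cons, ← wt_mul_left]
      simp [headDes, hy, hz.le, not_lt]
    have e₃ : des (y :: z :: zs) = headDes y [z] + des (z :: zs) := rfl
    simp only [e₁, e₃, e₂, List.sum_map_mul_left]
    rw [mul_add, mul_left_comm (1 - q) ((t * q) ^ _), ih]
    generalize wt (t * q) q (z :: zs) = W
    generalize des (z :: zs) = d
    obtain h | h : headDes y [z] = 0 ∨ headDes y [z] = 1 := by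
      simp only [headDes]; split_ifs <;> simp
    all_goals rw [h]; ring

theorem sum_wt_insert (t q : R) (a : ℤ) (w : List ℤ)
    (hw : (∀ x ∈ w, x < a) ∨ ∀ x ∈ w, a < x) :
    (1 - q) * ((List.permutations'Aux a w).map (wt t q)).sum =
      (1 - t * q ^ (w.length + 1)) * wt t q w - q * (1 - t) * wt (t * q) q w := by
  rw [wt_mul_left]
  cases w with
  | nil => simp [List.permutations'Aux, wt, des, maj, headDes]; ring
  | cons y ys =>
    simp only [List.permutations'Aux, List.map_cons, List.sum_cons, List.map_map,
      Function.comp_def, List.length_cons, mul_add]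
    rcases hw with hw | hw
    · rw [sum_wt_insert_max t q a y ys (hw y (by simp)) fun x hx => hw x (by simp [hx])]
      rw [wt_cons _ _ a, wt_mul_left]
      simp only [headDes, hw y (by simp), if_true]
      ring
    · rw [sum_wt_insert_min t q a y ys (hw y (by simp)) fun x hx => hw x (by simp [hx])]
      rw [wt_cons _ _ a, wt_mul_left]
      simp only [headDes, (hw y (by simp)).le, not_lt.2, if_false]
      ring

/-- The monomial `t ^ fd w * q ^ fmaj w`. -/
def flagWt (t q : R) (w : List ℤ) : R :=
  wt (t ^ 2) (q ^ 2) w * t ^ headNeg w * q ^ neg w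

theorem sum_flagWt_insert (t q : R) (a : ℤ) (w : List ℤ) (ha : 0 < a) (hw : ∀ x ∈ w, |x| < a) :
    (1 - q ^ 2) * (((List.permutations'Aux a w).map (flagWt t q)).sum +
        ((List.permutations'Aux (-a) w).map (flagWt t q)).sum) =
      (1 + q) * ((1 - t ^ 2 * q ^ (2 * (w.length + 1))) * flagWt t q w -
        q * (1 - t) * (1 + t * q) * flagWt (t * q) q w) := by
  have ha' : ¬ a < 0 := by omega
  cases w with
  | nil =>
    simp [List.permutations'Aux, flagWt, wt, des, maj, headDes, headNeg, neg, ha, ha']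
    ring
  | cons y ys =>
    have hmax : ∀ x ∈ y :: ys, x < a := fun x hx => (abs_lt.1 (hw x hx)).2
    have hmin : ∀ x ∈ y :: ys, -a < x := fun x hx => (abs_lt.1 (hw x hx)).1
    have emax := sum_wt_insert_max (t ^ 2) (q ^ 2) a y ys (hmax y (by simp))
      fun x hx => hmax x (by simp [hx])
    have emin := sum_wt_insert_min (t ^ 2) (q ^ 2) (-a) y ys (hmin y (by simp))
      fun x hx => hmin x (by simp [hx])
    have key : ∀ b : ℤ, ((List.permutations'Aux b ys).map fun v => flagWt t q (y :: v)).sum =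
        t ^ headNeg (y :: ys) * q ^ neg (b :: y :: ys) *
          ((List.permutations'Aux b ys).map fun v => wt (t ^ 2) (q ^ 2) (y :: v)).sum := by
      intro b
      rw [← List.sum_map_mul_left]
      congr 1
      refine List.map_congr_left fun v hv => ?_
      have hp : (y :: v).Perm (b :: y :: ys) :=
        ((perm_of_mem_permutations'Aux hv).cons y).trans (List.Perm.swap _ _ _)
      simp only [flagWt, neg_eq_of_perm hp, headNeg]
      ring
    simp only [List.permutations'Aux, List.map_cons, List.sum_cons, List.map_map,
      Function.comp_def, List.length_cons, key]
    have f₁ : flagWt t q (a :: y :: ys) = t ^ 2 * q ^ 2 * ((q ^ 2) ^ des (y :: ys) *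
        wt (t ^ 2) (q ^ 2) (y :: ys)) * q ^ neg (y :: ys) := by
      simp only [flagWt]
      rw [wt_cons, wt_mul_left]
      simp [headDes, hmax y (by simp), headNeg, ha', neg]
    have f₂ : flagWt t q (-a :: y :: ys) = (q ^ 2) ^ des (y :: ys) *
        wt (t ^ 2) (q ^ 2) (y :: ys) * t * q ^ (neg (y :: ys) + 1) := by
      simp only [flagWt]
      rw [wt_cons, wt_mul_left]
      simp [headDes, (hmin y (by simp)).le, headNeg, ha, neg, add_comm]
    have f₃ : flagWt (t * q) q (y :: ys) = (q ^ 2) ^ des (y :: ys) *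
        wt (t ^ 2) (q ^ 2) (y :: ys) * (t * q) ^ headNeg (y :: ys) * q ^ neg (y :: ys) := by
      simp only [flagWt, mul_pow t q 2, wt_mul_left]
    have f₄ : neg (a :: y :: ys) = neg (y :: ys) := by simp [neg, ha']
    have f₅ : neg (-a :: y :: ys) = neg (y :: ys) + 1 := by simp [neg, ha, add_comm]
    rw [f₁, f₂, f₃, f₄, f₅, flagWt]
    generalize neg (y :: ys) = N at *
    have hε : headNeg (y :: ys) = 0 ∨ headNeg (y :: ys) = 1 := by
      simp only [headNeg]; split_ifs <;> simp
    generalize headNeg (y :: ys) = ε at *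
    rcases hε with rfl | rfl
    · linear_combination q ^ N * emax + q ^ (N + 1) * emin
    · linear_combination t * q ^ N * emax + t * q ^ (N + 1) * emin

theorem sum_map_flatMap {α β : Type*} (L : List α) (g : α → List β) (f : β → R) :
    ((L.flatMap g).map f).sum = (L.map fun x => ((g x).map f).sum).sum := by
  induction L with
  | nil => simp
  | cons x L ih => simp [ih]

theorem sum_map_sub {α : Type*} (L : List α) (f g : α → R) :
    (L.map fun x => f x - g x).sum = (L.map f).sum - (L.map g).sum := by
  induction L with
  | nil => simp
  | cons x L ih => simp only [List.map_cons, List.sum_cons, ih]; ring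

end Weights

theorem perm_range_of_mem_words {n : ℕ} {w : List ℤ} (h : w ∈ words n) :
    (w.map Int.natAbs).Perm ((List.range n).map Nat.succ) := by
  induction n generalizing w with
  | zero => simp_all [words]
  | succ n ih =>
    simp only [words, List.mem_flatMap, List.mem_append] at h
    obtain ⟨u, hu, hw⟩ := h
    have hp : (w.map Int.natAbs).Perm ((n + 1) :: u.map Int.natAbs) := by
      rcases hw with hw | hw
      all_goals
        have := (perm_of_mem_permutations'Aux hw).map Int.natAbs
        rw [List.map_cons] at this
        convert this using 2
        omega
    rw [List.range_succ, List.map_append]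
    exact hp.trans (((ih hu).cons _).trans (List.perm_append_singleton _ _).symm)

theorem mem_words_of_perm_range {n : ℕ} {w : List ℤ}
    (h : (w.map Int.natAbs).Perm ((List.range n).map Nat.succ)) : w ∈ words n := by
  induction n generalizing w with
  | zero => simp_all [words]
  | succ n ih =>
    have hmem : n + 1 ∈ w.map Int.natAbs := h.mem_iff.2 (by simp)
    obtain ⟨x, hx, hxn⟩ := List.mem_map.1 hmem
    obtain ⟨l₁, l₂, rfl⟩ := List.append_of_mem hx
    simp only [words, List.mem_flatMap, List.mem_append]
    refine ⟨l₁ ++ l₂, ih ?_, ?_⟩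
    · rw [List.range_succ, List.map_append (l₁ := List.range n), List.map_singleton] at h
      have h' := (List.perm_middle (a := x) (l₁ := l₁) (l₂ := l₂)).map Int.natAbs
      rw [List.map_cons, hxn] at h'
      exact (h'.symm.trans (h.trans (List.perm_append_singleton (n + 1) _))).cons_inv
    · obtain rfl | rfl : x = (n : ℤ) + 1 ∨ x = -((n : ℤ) + 1) := by omega
      · exact Or.inl (append_cons_mem_permutations'Aux _ _ _)
      · exact Or.inr (append_cons_mem_permutations'Aux _ _ _)

theorem length_of_mem_words {n : ℕ} {w : List ℤ} (h : w ∈ words n) : w.length = n := by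
  simpa using (perm_range_of_mem_words h).length_eq

theorem abs_lt_of_mem_words {n : ℕ} {w : List ℤ} (h : w ∈ words n) {x : ℤ} (hx : x ∈ w) :
    |x| < (n : ℤ) + 1 := by
  have := (perm_range_of_mem_words h).mem_iff.1 (List.mem_map_of_mem hx)
  simp only [List.mem_map, List.mem_range] at this
  obtain ⟨i, hi, hix⟩ := this
  rw [Int.abs_eq_natAbs]
  omega

theorem filter_of_mem_permutations'Aux {n : ℕ} {a : ℤ} {w v : List ℤ} (ha : |a| = (n : ℤ) + 1)
    (hw : ∀ x ∈ w, |x| < (n : ℤ) + 1) (hv : v ∈ List.permutations'Aux a w) :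
    v.filter (fun x => |x| < (n : ℤ) + 1) = w := by
  induction w generalizing v with
  | nil => simp_all [List.permutations'Aux]
  | cons y w ih =>
    simp only [List.permutations'Aux, List.mem_cons, List.mem_map] at hv
    rcases hv with rfl | ⟨u, hu, rfl⟩
    · rw [List.filter_cons_of_neg (by simp [ha])]
      exact List.filter_eq_self.2 fun x hx => by simpa using hw x hx
    · rw [List.filter_cons_of_pos (by simpa using hw y (by simp)),
        ih (fun x hx => hw x (by simp [hx])) hu]

theorem nodup_words (n : ℕ) : (words n).Nodup := by
  induction n with
  | zero => simp [words]
  | succ n ih =>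
    have habs : |(n : ℤ) + 1| = (n : ℤ) + 1 := abs_of_nonneg (by omega)
    have hnot : ∀ w ∈ words n, ∀ a : ℤ, |a| = (n : ℤ) + 1 → a ∉ w := fun w hw a ha hmem => by
      have := abs_lt_of_mem_words hw hmem
      omega
    rw [words, List.nodup_flatMap]
    refine ⟨fun w hw => ?_, ?_⟩
    · refine List.nodup_append.2 ⟨List.nodup_permutations'Aux_of_notMem _ _ (hnot w hw _ habs),
        List.nodup_permutations'Aux_of_notMem _ _ (hnot w hw _ (by rw [abs_neg, habs])), ?_⟩
      rintro v hv _ hv' rfl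
      have h₁ : (n : ℤ) + 1 ∈ v := (perm_of_mem_permutations'Aux hv).mem_iff.2 (by simp)
      have h₂ := (perm_of_mem_permutations'Aux hv').mem_iff.1 h₁
      rcases List.mem_cons.1 h₂ with h | h
      · omega
      · exact hnot w hw _ habs h
    · refine ih.imp_of_mem fun {u v} hu hv huv x hxu hxv => huv ?_
      have key : ∀ w ∈ words n, x ∈ List.permutations'Aux ((n : ℤ) + 1) w ++
          List.permutations'Aux (-((n : ℤ) + 1)) w →
          x.filter (fun x => |x| < (n : ℤ) + 1) = w := by
        intro w hw hx
        rcases List.mem_append.1 hx with hx | hx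
        · exact filter_of_mem_permutations'Aux habs (fun _ => abs_lt_of_mem_words hw) hx
        · exact filter_of_mem_permutations'Aux (by rw [abs_neg, habs])
            (fun _ => abs_lt_of_mem_words hw) hx
      rw [← key u hu hxu, ← key v hv hxv]

section GeneratingFunctions

variable {R : Type*} [CommRing R]

/-- The generating function of `B_n` by descents (`t`), negative letters (`s`) and `nmaj` (`q`). -/
def negGF (n : ℕ) (t s q : R) : R :=
  ((words n).map fun w => s ^ neg w * q ^ negAbs w * wt t q w).sum

/-- The generating function of `B_n` by `fd` (`t`) and `fmaj` (`q`). -/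
def flagGF (n : ℕ) (t q : R) : R := ((words n).map (flagWt t q)).sum

theorem negGF_succ (n : ℕ) (t s q : R) :
    (1 - q) * negGF (n + 1) t s q = (1 + s * q ^ (n + 1)) *
      ((1 - t * q ^ (n + 1)) * negGF n t s q - q * (1 - t) * negGF n (t * q) s q) := by
  have key : ∀ w ∈ words n, ∀ a : ℤ, |a| = (n : ℤ) + 1 →
      (1 - q) * ((List.permutations'Aux a w).map
        fun v => s ^ neg v * q ^ negAbs v * wt t q v).sum =
      s ^ neg (a :: w) * q ^ negAbs (a :: w) *
        ((1 - t * q ^ (n + 1)) * wt t q w - q * (1 - t) * wt (t * q) q w) := by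
    intro w hw a ha
    have hlt : (∀ x ∈ w, x < a) ∨ ∀ x ∈ w, a < x := by
      rcases abs_choice a with h | h
      · exact Or.inl fun x hx => by have := abs_lt.1 (abs_lt_of_mem_words hw hx); omega
      · exact Or.inr fun x hx => by have := abs_lt.1 (abs_lt_of_mem_words hw hx); omega
    have := sum_wt_insert t q a w hlt
    rw [length_of_mem_words hw] at this
    rw [← this, mul_left_comm _ (1 - q),
      ← List.sum_map_mul_left (f := wt t q)]
    congr 2
    refine List.map_congr_left fun v hv => ?_
    have hp := perm_of_mem_permutations'Aux hv
    rw [neg_eq_of_perm hp, negAbs_eq_of_perm hp]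
  have habs : |(n : ℤ) + 1| = (n : ℤ) + 1 := abs_of_nonneg (by omega)
  simp only [negGF, words, sum_map_flatMap, List.map_append, List.sum_append]
  rw [← List.sum_map_mul_left, ← List.sum_map_mul_left, ← List.sum_map_mul_left,
    ← sum_map_sub, ← List.sum_map_mul_left]
  congr 1
  refine List.map_congr_left fun w hw => ?_
  rw [mul_add, key w hw _ habs, key w hw _ (by rw [abs_neg, habs])]
  have h₁ : ¬ (n : ℤ) + 1 < 0 := by omega
  have h₂ : -((n : ℤ) + 1) < 0 := by omega
  have h₃ : (-((n : ℤ) + 1)).natAbs = n + 1 := by omega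
  simp only [neg, negAbs, h₁, h₂, h₃, if_true, if_false]
  ring

theorem flagGF_succ (n : ℕ) (t q : R) :
    (1 - q ^ 2) * flagGF (n + 1) t q = (1 + q) * ((1 - t ^ 2 * q ^ (2 * (n + 1))) * flagGF n t q -
      q * (1 - t) * (1 + t * q) * flagGF n (t * q) q) := by
  simp only [flagGF, words, sum_map_flatMap, List.map_append, List.sum_append]
  rw [← List.sum_map_mul_left, ← List.sum_map_mul_left, ← List.sum_map_mul_left,
    ← sum_map_sub, ← List.sum_map_mul_left]
  congr 1
  refine List.map_congr_left fun w hw => ?_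
  rw [sum_flagWt_insert t q _ w (by omega) fun x => abs_lt_of_mem_words hw,
    length_of_mem_words hw]

theorem negGF_eq_prod_mul [IsDomain R] (n : ℕ) (t s : R) {q : R} (hq : q ≠ 1) :
    negGF n t s q = (∏ i ∈ range n, (1 + s * q ^ (i + 1))) * negGF n t 0 q := by
  induction n generalizing t with
  | zero => simp [negGF, words, neg, negAbs]
  | succ n ih =>
    refine mul_left_cancel₀ (sub_ne_zero.2 hq.symm) ?_
    rw [mul_left_comm, negGF_succ, negGF_succ, ih t, ih (t * q), prod_range_succ]
    ring

theorem negGF_eq_flagGF [IsDomain R] (n : ℕ) (t : R) {q : R} (hq : q ^ 2 ≠ 1) :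
    negGF n t t q = flagGF n t q := by
  have hq₁ : q ≠ 1 := by rintro rfl; simp at hq
  induction n generalizing t with
  | zero => simp [negGF, flagGF, flagWt, words, neg, negAbs, wt, des, maj, headNeg]
  | succ n ih =>
    refine mul_left_cancel₀ (sub_ne_zero.2 hq.symm) ?_
    have hshift : (1 + t * q ^ (n + 1)) * negGF n (t * q) t q =
        (1 + t * q) * negGF n (t * q) (t * q) q := by
      rw [negGF_eq_prod_mul n (t * q) t hq₁, negGF_eq_prod_mul n (t * q) (t * q) hq₁,
        ← mul_assoc, ← mul_assoc]
      congr 1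
      have := prod_range_succ' (fun i => 1 + t * q ^ (i + 1)) n
      rw [prod_range_succ] at this
      rw [mul_comm, this, zero_add, pow_one, mul_comm]
      congr 1
      exact prod_congr rfl fun i _ => by ring
    rw [flagGF_succ, ← ih t, ← ih (t * q)]
    linear_combination (1 + q) * negGF_succ n t t q - (1 + q) * q * (1 - t) * hshift

end GeneratingFunctions

/-- The window `[π(1), …, π(n)]` of a signed permutation. -/
def window (n : ℕ) (π : Equiv.Perm ℤ) : List ℤ := (List.range n).map fun i : ℕ => π ((i : ℤ) + 1)

theorem map_range_succ {α : Type*} (n : ℕ) (p : ℕ → α) :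
    (List.range (n + 1)).map p = p 0 :: (List.range n).map fun i => p (i + 1) := by
  simp [List.range_succ_eq_map, Function.comp_def]

theorem headDes_map_range (x : ℤ) (n : ℕ) (p : ℕ → ℤ) :
    headDes x ((List.range (n + 1)).map p) = if p 0 < x then 1 else 0 := by
  rw [map_range_succ]; rfl

theorem des_map_range (n : ℕ) (p : ℕ → ℤ) :
    des ((List.range n).map p) = ∑ i ∈ range (n - 1), if p (i + 1) < p i then 1 else 0 := by
  induction n generalizing p with
  | zero => rfl
  | succ n ih =>
    rw [map_range_succ, des, ih]
    cases n with
    | zero => rfl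
    | succ n =>
      rw [headDes_map_range, Nat.add_sub_cancel, Nat.add_sub_cancel, sum_range_succ' _ n, add_comm]

theorem maj_map_range (n : ℕ) (p : ℕ → ℤ) :
    maj ((List.range n).map p) = ∑ i ∈ range (n - 1), if p (i + 1) < p i then i + 1 else 0 := by
  induction n generalizing p with
  | zero => rfl
  | succ n ih =>
    rw [map_range_succ, maj, ih, des_map_range]
    cases n with
    | zero => rfl
    | succ n =>
      rw [headDes_map_range, Nat.add_sub_cancel, Nat.add_sub_cancel, sum_range_succ' _ n,
        add_assoc, ← sum_add_distrib, add_comm]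
      congr 1
      refine sum_congr rfl fun i _ => ?_
      split_ifs <;> omega

theorem neg_map_range (n : ℕ) (p : ℕ → ℤ) :
    neg ((List.range n).map p) = ∑ i ∈ range n, if p i < 0 then 1 else 0 := by
  induction n generalizing p with
  | zero => rfl
  | succ n ih => rw [map_range_succ, neg, ih, sum_range_succ' _ n, add_comm]

theorem negAbs_map_range (n : ℕ) (p : ℕ → ℤ) :
    negAbs ((List.range n).map p) = ∑ i ∈ range n, if p i < 0 then (p i).natAbs else 0 := by
  induction n generalizing p with
  | zero => rfl
  | succ n ih => rw [map_range_succ, negAbs, ih, sum_range_succ' _ n, add_comm]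

theorem sum_Icc_one (m : ℕ) (f : ℕ → ℕ) : ∑ i ∈ Icc 1 m, f i = ∑ i ∈ range m, f (i + 1) := by
  induction m with
  | zero => rfl
  | succ m ih => rw [sum_Icc_succ_top (by omega), ih, sum_range_succ]

theorem des_window (n : ℕ) (π : Equiv.Perm ℤ) : des (window n π) = desA n π := by
  rw [window, des_map_range, desA, DesA, card_filter, sum_Icc_one]
  push_cast; rfl

theorem maj_window (n : ℕ) (π : Equiv.Perm ℤ) : maj (window n π) = majA n π := by
  rw [window, maj_map_range, majA, DesA, sum_filter, sum_Icc_one]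
  push_cast; rfl

theorem neg_window (n : ℕ) (π : Equiv.Perm ℤ) : neg (window n π) = negStat n π := by
  rw [window, neg_map_range, negStat, NegSet, card_filter, sum_Icc_one]
  push_cast; rfl

theorem negAbs_window (n : ℕ) (π : Equiv.Perm ℤ) : negAbs (window n π) = negSum n π := by
  rw [window, negAbs_map_range, negSum, NegSet, sum_filter, sum_Icc_one]
  push_cast; rfl

theorem headNeg_window {n : ℕ} (hn : 1 ≤ n) (π : Equiv.Perm ℤ) :
    headNeg (window n π) = if π 1 < 0 then 1 else 0 := by
  obtain ⟨m, rfl⟩ := Nat.exists_eq_add_of_le' hn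
  rw [window, map_range_succ]
  simp [headNeg]

theorem apply_zero {n : ℕ} {π : Equiv.Perm ℤ} (hπ : IsSignedPerm n π) : π 0 = 0 := by
  have := hπ.1 0
  simp only [neg_zero] at this
  omega

theorem window_injOn (n : ℕ) : Set.InjOn (window n) (BSet n) := by
  intro π hπ σ hσ h
  have hpos : ∀ i : ℕ, i < n → π ((i : ℤ) + 1) = σ ((i : ℤ) + 1) := fun i hi =>
    List.map_inj_left.1 h i (List.mem_range.2 hi)
  have hnonneg : ∀ a : ℤ, 0 ≤ a → π a = σ a := by
    intro a ha
    rcases ha.eq_or_lt with rfl | ha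
    · rw [apply_zero hπ, apply_zero hσ]
    by_cases han : a ≤ n
    · have := hpos (a - 1).toNat (by omega)
      rwa [show (((a - 1).toNat : ℕ) : ℤ) + 1 = a by omega] at this
    · have : (n : ℤ) < |a| := by rw [abs_of_pos ha]; omega
      rw [hπ.2 a this, hσ.2 a this]
  ext a
  rcases le_total 0 a with ha | ha
  · exact hnonneg a ha
  · have := hnonneg (-a) (by omega)
    rw [hπ.1, hσ.1] at this
    omega

theorem window_mem_words {n : ℕ} {π : Equiv.Perm ℤ} (hπ : IsSignedPerm n π) :
    window n π ∈ words n := by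
  apply mem_words_of_perm_range
  have hinj : ((window n π).map Int.natAbs).Nodup := by
    rw [window, List.map_map]
    refine List.Nodup.map_on ?_ List.nodup_range
    intro i _ j _ hij
    rcases Int.natAbs_eq_natAbs_iff.1 hij with h | h
    · have := π.injective h
      omega
    · rw [← hπ.1] at h
      have := π.injective h
      omega
  refine (List.subperm_of_subset hinj ?_).perm_of_length_le (by simp [window])
  intro k hk
  simp only [window, List.mem_map, List.mem_range] at hk
  obtain ⟨_, ⟨i, hi, rfl⟩, rfl⟩ := hk
  have h₀ : π ((i : ℤ) + 1) ≠ 0 := by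
    rw [← apply_zero hπ]
    intro h
    have := π.injective h
    omega
  have hn : |π ((i : ℤ) + 1)| ≤ n := by
    by_contra hlt
    have h := π.injective (hπ.2 _ (not_le.1 hlt))
    rw [h, abs_of_nonneg (by omega)] at hlt
    omega
  rw [Int.abs_eq_natAbs] at hn
  exact List.mem_map.2 ⟨(π ((i : ℤ) + 1)).natAbs - 1, List.mem_range.2 (by omega), by omega⟩

/-- The odd extension to `ℤ` of a word, fixing every `a` with `|a|` larger than its length. -/
def oddExtend (w : List ℤ) (a : ℤ) : ℤ :=
  if h : a.natAbs - 1 < w.length then a.sign * w[a.natAbs - 1] else a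

theorem oddExtend_neg (w : List ℤ) (a : ℤ) : oddExtend w (-a) = -oddExtend w a := by
  simp only [oddExtend, Int.natAbs_neg, Int.sign_neg]
  split_ifs <;> ring

theorem natAbs_oddExtend {w : List ℤ} {a : ℤ} (ha : a ≠ 0) (h : a.natAbs - 1 < w.length) :
    (oddExtend w a).natAbs = (w[a.natAbs - 1]).natAbs := by
  rw [oddExtend, dif_pos h, Int.natAbs_mul, Int.natAbs_sign_of_ne_zero ha, one_mul]

theorem oddExtend_zero (w : List ℤ) : oddExtend w 0 = 0 := by
  simp [oddExtend]

theorem oddExtend_natCast_add_one {w : List ℤ} {i : ℕ} (hi : i < w.length) :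
    oddExtend w ((i : ℤ) + 1) = w[i] := by
  have h₁ : ((i : ℤ) + 1).natAbs - 1 = i := by omega
  have h₂ : ((i : ℤ) + 1).sign = 1 := Int.sign_eq_one_of_pos (by omega)
  simp only [oddExtend, h₁, h₂, hi, dif_pos, one_mul]

theorem bijective_oddExtend {n : ℕ} {w : List ℤ} (hw : w ∈ words n) :
    Function.Bijective (oddExtend w) := by
  have hlen := length_of_mem_words hw
  have hperm := perm_range_of_mem_words hw
  have hnodup : (w.map Int.natAbs).Nodup :=
    hperm.nodup_iff.2 (List.nodup_range.map Nat.succ_injective)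
  have hmem : ∀ i (hi : i < w.length), 0 < (w[i]).natAbs ∧ (w[i]).natAbs ≤ n := by
    intro i hi
    have := hperm.mem_iff.1 (List.mem_map_of_mem (List.getElem_mem hi))
    simp only [List.mem_map, List.mem_range] at this
    omega
  have hinj : ∀ i j (hi : i < w.length) (hj : j < w.length),
      (w[i]).natAbs = (w[j]).natAbs → i = j := fun i j hi hj h =>
    (hnodup.getElem_inj_iff (hi := by simpa using hi) (hj := by simpa using hj)).1
      (by simpa using h)
  have hbig : ∀ a : ℤ, n < a.natAbs → oddExtend w a = a := fun a ha =>
    dif_neg (by omega)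
  have hsmall : ∀ a : ℤ, a ≠ 0 → a.natAbs ≤ n →
      0 < (oddExtend w a).natAbs ∧ (oddExtend w a).natAbs ≤ n := fun a ha han => by
    have h : a.natAbs - 1 < w.length := by omega
    rw [natAbs_oddExtend ha h]
    exact hmem _ h
  have hzero : ∀ a, oddExtend w a = 0 → a = 0 := by
    intro a h
    by_contra ha
    rcases le_or_gt a.natAbs n with han | han
    · have := hsmall a ha han
      omega
    · exact ha (hbig a han ▸ h)
  constructor
  · intro a b hab
    by_cases ha : a = 0
    · rw [ha, oddExtend_zero] at hab
      rw [ha, hzero b hab.symm]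
    by_cases hb : b = 0
    · rw [hb, oddExtend_zero] at hab
      rw [hb, hzero a hab]
    rcases le_or_gt a.natAbs n with han | han <;> rcases le_or_gt b.natAbs n with hbn | hbn
    · have h := congrArg Int.natAbs hab
      rw [natAbs_oddExtend ha (by omega), natAbs_oddExtend hb (by omega)] at h
      have := hinj _ _ _ _ h
      obtain h | h : a = b ∨ a = -b := by omega
      · exact h
      · rw [h, oddExtend_neg] at hab
        exact absurd (hzero b (by omega)) hb
    · have := hsmall a ha han
      have := hbig b hbn
      omega
    · have := hsmall b hb hbn
      have := hbig a han
      omega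
    · rwa [hbig a han, hbig b hbn] at hab
  · intro b
    by_cases hb : b = 0
    · exact ⟨0, by rw [hb, oddExtend_zero]⟩
    rcases le_or_gt b.natAbs n with hbn | hbn
    · have hmem_w : b.natAbs ∈ w.map Int.natAbs := hperm.mem_iff.2
        (List.mem_map.2 ⟨b.natAbs - 1, List.mem_range.2 (by omega), by omega⟩)
      obtain ⟨x, hx, hxb⟩ := List.mem_map.1 hmem_w
      obtain ⟨i, hi, rfl⟩ := List.getElem_of_mem hx
      have hval := oddExtend_natCast_add_one hi
      rcases Int.natAbs_eq_natAbs_iff.1 hxb with h | h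
      · exact ⟨_, hval.trans h⟩
      · exact ⟨-((i : ℤ) + 1), by rw [oddExtend_neg, hval, h, neg_neg]⟩
    · exact ⟨b, hbig b hbn⟩

theorem image_window (n : ℕ) : window n '' BSet n = ↑(words n).toFinset := by
  ext w
  simp only [Set.mem_image, mem_coe, List.mem_toFinset]
  refine ⟨fun ⟨π, hπ, h⟩ => h ▸ window_mem_words hπ, fun hw => ?_⟩
  have hlen := length_of_mem_words hw
  refine ⟨Equiv.ofBijective _ (bijective_oddExtend hw), ⟨fun a => ?_, fun a ha => ?_⟩, ?_⟩
  · exact oddExtend_neg w a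
  · simp only [Equiv.ofBijective_apply, oddExtend]
    rw [dif_neg]
    rw [Int.abs_eq_natAbs] at ha
    omega
  · refine List.ext_getElem (by simp [window, hlen]) fun i h₁ h₂ => ?_
    simp only [window, List.getElem_map, List.getElem_range, Equiv.ofBijective_apply,
      oddExtend_natCast_add_one h₂]

theorem finsum_BSet {R : Type*} [CommRing R] (n : ℕ) (f : List ℤ → R) :
    ∑ᶠ π ∈ BSet n, f (window n π) = ((words n).map f).sum := by
  rw [← finsum_mem_image (window_injOn n), image_window, finsum_mem_coe_finset,
    List.sum_toFinset f (nodup_words n)]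

end SignedWord

theorem stmt_18 (n : ℕ) (hn : 1 ≤ n) :
    (∑ᶠ π ∈ BSet n, (MvPolynomial.X 0 : MvPolynomial (Fin 2) ℤ) ^ ndes n π *
        MvPolynomial.X 1 ^ nmaj n π) =
    ∑ᶠ π ∈ BSet n, (MvPolynomial.X 0 : MvPolynomial (Fin 2) ℤ) ^ fd n π *
        MvPolynomial.X 1 ^ fmaj n π := by
  have hq : (MvPolynomial.X 1 : MvPolynomial (Fin 2) ℤ) ^ 2 ≠ 1 := by
    intro h
    have := congrArg (MvPolynomial.eval fun _ => (2 : ℤ)) h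
    norm_num at this
  have hneg := SignedWord.finsum_BSet n fun w => (MvPolynomial.X 0 : MvPolynomial (Fin 2) ℤ) ^
    SignedWord.neg w * MvPolynomial.X 1 ^ SignedWord.negAbs w *
      SignedWord.wt (MvPolynomial.X 0) (MvPolynomial.X 1) w
  have hflag := SignedWord.finsum_BSet n
    (SignedWord.flagWt (MvPolynomial.X 0 : MvPolynomial (Fin 2) ℤ) (MvPolynomial.X 1))
  refine Eq.trans ?_ (hneg.trans ((SignedWord.negGF_eq_flagGF n _ hq).trans (hflag.symm.trans ?_)))
  · refine finsum_congr fun π => finsum_congr fun _ => ?_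
    simp only [SignedWord.wt, SignedWord.des_window, SignedWord.maj_window,
      SignedWord.neg_window, SignedWord.negAbs_window, ndes, nmaj]
    ring
  · refine finsum_congr fun π => finsum_congr fun _ => ?_
    simp only [SignedWord.flagWt, SignedWord.wt, SignedWord.des_window, SignedWord.maj_window,
      SignedWord.neg_window, SignedWord.headNeg_window hn, fd, fmaj]
    ring
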